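/- Let (v,w) be a pair of distinct binary words of the same length having property R, and let s = ‖v‖₁ − ‖w‖₁ (an integer, possibly negative). Then for every p ∈ (0,1), Win(v,w;p) = ℙ_p(v)/(ℙ_p(v) + ℙ_p(w)) = p^s/(p^s + (1−p)^s). -/

import Mathlib

open scoped BigOperators

/-- Bernoulli(p) weight of a binary word `u`: `ℙ_p(u) = p^{‖u‖₁} (1-p)^{‖u‖₀}`. -/
noncomputable def wProb (p : ℝ) (u : List Bool) : ℝ :=
  p ^ (u.count true) * (1 - p) ^ (u.count false)

/-- Number of occurrences of `v` as a contiguous subword of `u`. -/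
def occCount (v u : List Bool) : ℕ :=
  (List.range (u.length + 1)).countP (fun i => decide (v <+: u.drop i))

/-- `Ω_{v,w}(v)`: binary words having `v` as a suffix, containing `v` exactly once
as a subword, and not containing `w` as a subword.  (`Ω_{v,w}(w) = OmegaWin w v`.) -/
def OmegaWin (v w : List Bool) : Set (List Bool) :=
  {u | v <:+ u ∧ occCount v u = 1 ∧ ¬ (w <:+: u)}

/-- The win probability `Win(v,w;p) = ∑_{u ∈ Ω_{v,w}(v)} ℙ_p(u)`. -/
noncomputable def Win (v w : List Bool) (p : ℝ) : ℝ :=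
  ∑' u : OmegaWin v w, wProb p u

/-- The correlation polynomial `vw_p = ∑_{u ∈ O(v,w)} ℙ_p(u)⁻¹`, where `O(v,w)` is
the set of nonempty words that are simultaneously a suffix of `v` and a prefix of `w`. -/
noncomputable def corr (v w : List Bool) (p : ℝ) : ℝ :=
  ∑ i ∈ Finset.Icc 1 w.length,
    if w.take i <:+ v then (wProb p (w.take i))⁻¹ else 0

/-- `Ω*_{v,w}(v) = {x : x ++ v ∈ Ω_{v,w}(v)}` (with `x` possibly empty). -/
def OmegaStarV (v w : List Bool) : Set (List Bool) :=
  {x | x ++ v ∈ OmegaWin v w}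

/-- Property `R`: `Ω*_{v,w}(v) = Ω*_{v,w}(w)`. -/
def PropR (v w : List Bool) : Prop :=
  OmegaStarV v w = {x | x ++ w ∈ OmegaWin w v}

/-- `D(v,w)`: nonempty proper prefixes `v₁⋯v_{n-k}` of `v` (`1 ≤ k ≤ n-1`) such that
`w₁⋯w_k = v_{n-k+1}⋯v_n`. -/
def Dset (v w : List Bool) : Set (List Bool) :=
  {x | ∃ k, 1 ≤ k ∧ k ≤ v.length - 1 ∧ k ≤ w.length ∧
    x = v.take (v.length - k) ∧ w.take k = v.drop (v.length - k)}

/-- `F(v,w) = D(v,v) ∪ D(w,w) ∪ D(w,v) ∪ D(v,w)`. -/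
def Fset (v w : List Bool) : Set (List Bool) :=
  Dset v v ∪ Dset w w ∪ Dset w v ∪ Dset v w

/-- `a^m`: concatenation of `m` copies of the word `a`. -/
def wpow (a : List Bool) (m : ℕ) : List Bool :=
  (List.replicate m a).flatten
theorem occCount_cons (v u : List Bool) (a : Bool) :
    occCount v (a :: u) = occCount v u + if v <+: a :: u then 1 else 0 := by
  unfold occCount
  rw [List.length_cons, List.range_succ_eq_map, List.countP_cons, List.countP_map]
  simp [Function.comp_def]

theorem occCount_concat {v : List Bool} (hv : v ≠ []) (u : List Bool) (b : Bool) :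
    occCount v (u ++ [b]) = occCount v u + if v <:+ u ++ [b] then 1 else 0 := by
  induction u with
  | nil =>
    have h : v <+: [b] ↔ v <:+ [b] := by
      have h1 := @List.prefix_concat_iff _ v [] b
      have h2 := @List.suffix_cons_iff _ v b []
      simp_all
    rw [List.nil_append, occCount_cons]
    simp [h]
  | cons a u ih =>
    rw [List.cons_append, occCount_cons, occCount_cons, ih]
    have h1 : v <+: a :: (u ++ [b]) ↔ v = a :: (u ++ [b]) ∨ v <+: a :: u :=
      @List.prefix_concat_iff _ v (a :: u) b
    have h2 := @List.suffix_cons_iff _ v a (u ++ [b])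
    by_cases h : v = a :: (u ++ [b])
    · have h3 : ¬ v <+: a :: u := fun hh => by
        have := hh.length_le
        simp [h] at this
      have h4 : ¬ v <:+ u ++ [b] := fun hh => by
        have := hh.length_le
        simp [h] at this
      have h5 := h1.2 (Or.inl h)
      have h6 := h2.2 (Or.inl h)
      simp only [h3, h4, h5, h6, if_true, if_false]
    · have h1' : v <+: a :: (u ++ [b]) ↔ v <+: a :: u := by tauto
      have h2' : v <:+ a :: (u ++ [b]) ↔ v <:+ u ++ [b] := by tauto
      simp only [h1', h2']
      omega

theorem occCount_eq_zero_iff (v u : List Bool) : occCount v u = 0 ↔ ¬ v <:+: u := by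
  induction u with
  | nil => simp [occCount]
  | cons a u ih =>
    rw [occCount_cons, List.infix_cons_iff]
    split_ifs with h <;> simp [h, ih]

theorem not_nil_mem_omegaWin {v : List Bool} (hv : v ≠ []) (w : List Bool) :
    [] ∉ OmegaWin v w := fun h => hv (List.suffix_nil.1 h.1)

theorem concat_mem_omegaWin_iff {v w : List Bool} (hv : v ≠ []) (hne : v ≠ w)
    (hlen : v.length = w.length) (u : List Bool) (b : Bool) :
    u ++ [b] ∈ OmegaWin v w ↔ (¬ v <:+: u ∧ ¬ w <:+: u) ∧ v <:+ u ++ [b] := by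
  simp only [OmegaWin, Set.mem_ofPred_eq, occCount_concat hv, List.infix_concat_iff]
  constructor
  · rintro ⟨h1, h2, h3⟩
    rw [if_pos h1] at h2
    exact ⟨⟨(occCount_eq_zero_iff v u).1 (by omega), fun h => h3 (Or.inr h)⟩, h1⟩
  · rintro ⟨⟨h1, h2⟩, h3⟩
    refine ⟨h3, by rw [if_pos h3, (occCount_eq_zero_iff v u).2 h1], ?_⟩
    rintro (h | h)
    · exact hne ((List.suffix_of_suffix_length_le h3 h hlen.le).eq_of_length hlen)
    · exact h2 h

theorem disjoint_omegaWin (v w : List Bool) : Disjoint (OmegaWin v w) (OmegaWin w v) :=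
  Set.disjoint_left.2 fun _ h1 h2 => h1.2.2 h2.1.isInfix

/-- The finite set of binary words of length `n`. -/
def wordsOfLength : ℕ → Finset (List Bool)
  | 0 => {[]}
  | n + 1 => (wordsOfLength n ×ˢ (Finset.univ : Finset Bool)).image fun x => x.1 ++ [x.2]

theorem mem_wordsOfLength {n : ℕ} {u : List Bool} : u ∈ wordsOfLength n ↔ u.length = n := by
  induction n generalizing u with
  | zero => simp [wordsOfLength]
  | succ n ih =>
    rcases List.eq_nil_or_concat u with rfl | ⟨u, b, rfl⟩
    · simp [wordsOfLength]
    · simp [wordsOfLength, ih]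

theorem sum_wordsOfLength_succ (n : ℕ) (f : List Bool → ℝ) :
    ∑ u ∈ wordsOfLength (n + 1), f u =
      ∑ u ∈ wordsOfLength n, (f (u ++ [true]) + f (u ++ [false])) := by
  rw [wordsOfLength, Finset.sum_image, Finset.sum_product]
  · simp
  · rintro ⟨x, a⟩ - ⟨y, b⟩ - h
    simpa using h

theorem sum_wordsOfLength_add (n m : ℕ) (f : List Bool → ℝ) :
    ∑ u ∈ wordsOfLength (n + m), f u =
      ∑ x ∈ wordsOfLength n, ∑ y ∈ wordsOfLength m, f (x ++ y) := by
  induction m generalizing f with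
  | zero => simp [wordsOfLength]
  | succ m ih =>
    rw [← Nat.add_assoc, sum_wordsOfLength_succ, ih]
    simp only [sum_wordsOfLength_succ, List.append_assoc]

theorem wProb_append (p : ℝ) (x y : List Bool) : wProb p (x ++ y) = wProb p x * wProb p y := by
  simp only [wProb, List.count_append, pow_add]
  ring

theorem wProb_pos {p : ℝ} (hp : p ∈ Set.Ioo (0 : ℝ) 1) (u : List Bool) : 0 < wProb p u :=
  mul_pos (pow_pos hp.1 _) (pow_pos (sub_pos.2 hp.2) _)

theorem wProb_concat_add (p : ℝ) (u : List Bool) :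
    wProb p (u ++ [true]) + wProb p (u ++ [false]) = wProb p u := by
  simp only [wProb_append]
  simp [wProb]
  ring

theorem sum_wProb_wordsOfLength (p : ℝ) (n : ℕ) : ∑ u ∈ wordsOfLength n, wProb p u = 1 := by
  induction n with
  | zero => simp [wordsOfLength, wProb]
  | succ n ih => simp only [sum_wordsOfLength_succ, wProb_concat_add, ih]

/-- The words containing neither `v` nor `w` as a subword. -/
def avoiding (v w : List Bool) : Set (List Bool) :=
  {u | ¬ v <:+: u ∧ ¬ w <:+: u}

/-- The probability that the first `n` letters contain neither `v` nor `w`. -/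
noncomputable def avoidProb (v w : List Bool) (p : ℝ) (n : ℕ) : ℝ :=
  ∑ u ∈ wordsOfLength n, (avoiding v w).indicator (wProb p) u

theorem avoidProb_nonneg {p : ℝ} (hp : p ∈ Set.Ioo (0 : ℝ) 1) (v w : List Bool) (n : ℕ) :
    0 ≤ avoidProb v w p n :=
  Finset.sum_nonneg fun _ _ => Set.indicator_nonneg (fun u _ => (wProb_pos hp u).le) _

theorem avoidProb_add_length_le {p : ℝ} (hp : p ∈ Set.Ioo (0 : ℝ) 1) (v w : List Bool) (n : ℕ) :
    avoidProb v w p (n + v.length) ≤ avoidProb v w p n * (1 - wProb p v) := by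
  rw [avoidProb, sum_wordsOfLength_add, avoidProb, Finset.sum_mul]
  refine Finset.sum_le_sum fun x _ => ?_
  have hmem : v ∈ wordsOfLength v.length := mem_wordsOfLength.2 rfl
  by_cases hx : x ∈ avoiding v w
  · rw [Set.indicator_of_mem hx, ← sum_wProb_wordsOfLength p v.length,
      ← Finset.add_sum_erase _ _ hmem, ← Finset.add_sum_erase _ _ hmem, add_sub_cancel_left,
      Set.indicator_of_notMem fun h => h.1 (List.suffix_append x v).isInfix, zero_add,
      Finset.mul_sum]
    refine Finset.sum_le_sum fun y _ => ?_
    rw [← wProb_append]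
    exact Set.indicator_le_self' (fun u _ => (wProb_pos hp u).le) _
  · rw [Set.indicator_of_notMem hx, zero_mul]
    refine (Finset.sum_eq_zero fun y _ => Set.indicator_of_notMem (fun h => hx ?_) _).le
    exact ⟨fun h' => h.1 (h'.trans (List.prefix_append x y).isInfix),
      fun h' => h.2 (h'.trans (List.prefix_append x y).isInfix)⟩

theorem sum_indicator_omegaWin_union {v w : List Bool} (hv : v ≠ []) (hne : v ≠ w)
    (hlen : v.length = w.length) (p : ℝ) (n : ℕ) :
    ∑ u ∈ wordsOfLength (n + 1), (OmegaWin v w ∪ OmegaWin w v).indicator (wProb p) u =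
      avoidProb v w p n - avoidProb v w p (n + 1) := by
  have hw : w ≠ [] := by
    rintro rfl
    exact hv (List.length_eq_zero_iff.1 hlen)
  have key : ∀ u b, (OmegaWin v w ∪ OmegaWin w v).indicator (wProb p) (u ++ [b]) +
      (avoiding v w).indicator (wProb p) (u ++ [b]) =
      (avoiding v w).indicator (fun _ => wProb p (u ++ [b])) u := by
    intro u b
    have h1 := concat_mem_omegaWin_iff hv hne hlen u b
    have h2 := concat_mem_omegaWin_iff hw hne.symm hlen.symm u b
    have h3 := @List.infix_concat_iff _ v u b
    have h4 := @List.infix_concat_iff _ w u b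
    simp only [Set.indicator, Set.mem_union, h1, h2, avoiding, Set.mem_ofPred_eq, h3, h4]
    by_cases a1 : v <:+: u <;> by_cases a2 : w <:+: u <;> by_cases a3 : v <:+ u ++ [b] <;>
      by_cases a4 : w <:+ u ++ [b] <;> simp [a1, a2, a3, a4]
  rw [eq_sub_iff_add_eq]
  simp only [avoidProb]
  rw [← Finset.sum_add_distrib, sum_wordsOfLength_succ]
  refine Finset.sum_congr rfl fun u _ => ?_
  rw [key, key]
  by_cases hu : u ∈ avoiding v w <;> simp [hu, wProb_concat_add]

theorem tendsto_avoidProb {v w : List Bool} (hv : v ≠ []) (hne : v ≠ w)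
    (hlen : v.length = w.length) {p : ℝ} (hp : p ∈ Set.Ioo (0 : ℝ) 1) :
    Filter.Tendsto (avoidProb v w p) Filter.atTop (nhds 0) := by
  have hanti : Antitone (avoidProb v w p) := by
    refine antitone_nat_of_succ_le fun n => ?_
    rw [← sub_nonneg, ← sum_indicator_omegaWin_union hv hne hlen]
    exact Finset.sum_nonneg fun _ _ => Set.indicator_nonneg (fun u _ => (wProb_pos hp u).le) _
  have hlim := tendsto_atTop_ciInf hanti
    ⟨0, by rintro _ ⟨n, rfl⟩; exact avoidProb_nonneg hp v w n⟩
  set l := ⨅ n, avoidProb v w p n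
  have h0 : 0 ≤ l := ge_of_tendsto' hlim (avoidProb_nonneg hp v w)
  have h1 : l ≤ l * (1 - wProb p v) :=
    le_of_tendsto_of_tendsto' ((Filter.tendsto_add_atTop_iff_nat v.length).2 hlim)
      (hlim.mul_const _) (avoidProb_add_length_le hp v w)
  have h2 : l = 0 := by nlinarith [wProb_pos hp v]
  rwa [h2] at hlim

/-- The finite set of binary words of length at most `n`. -/
def wordsOfLengthLE (n : ℕ) : Finset (List Bool) :=
  (Finset.range (n + 1)).biUnion wordsOfLength

theorem mem_wordsOfLengthLE {n : ℕ} {u : List Bool} : u ∈ wordsOfLengthLE n ↔ u.length ≤ n := by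
  simp [wordsOfLengthLE, mem_wordsOfLength]

theorem sum_wordsOfLengthLE_indicator {v w : List Bool} (hv : v ≠ []) (hne : v ≠ w)
    (hlen : v.length = w.length) (p : ℝ) (n : ℕ) :
    ∑ u ∈ wordsOfLengthLE n, (OmegaWin v w ∪ OmegaWin w v).indicator (wProb p) u =
      1 - avoidProb v w p n := by
  have hw : w ≠ [] := by
    rintro rfl
    exact hv (List.length_eq_zero_iff.1 hlen)
  rw [wordsOfLengthLE, Finset.sum_biUnion]
  · rw [Finset.sum_range_succ', Finset.sum_congr rfl
      fun k _ => sum_indicator_omegaWin_union hv hne hlen p k, Finset.sum_range_sub']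
    have h1 : ([] : List Bool) ∉ OmegaWin v w ∪ OmegaWin w v := by
      simp [not_nil_mem_omegaWin hv, not_nil_mem_omegaWin hw]
    have h2 : ([] : List Bool) ∈ avoiding v w := by simp [avoiding, hv, hw]
    simp only [avoidProb, wordsOfLength, Finset.sum_singleton, Set.indicator_of_mem h2,
      Set.indicator_of_notMem h1]
    simp [wProb]
  · intro i _ j _ hij
    refine Finset.disjoint_left.2 fun u h1 h2 => hij ?_
    rw [← mem_wordsOfLength.1 h1, ← mem_wordsOfLength.1 h2]

theorem hasSum_indicator_omegaWin_union {v w : List Bool} (hv : v ≠ []) (hne : v ≠ w)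
    (hlen : v.length = w.length) {p : ℝ} (hp : p ∈ Set.Ioo (0 : ℝ) 1) :
    HasSum ((OmegaWin v w ∪ OmegaWin w v).indicator (wProb p)) 1 := by
  have hnonneg : ∀ u, 0 ≤ (OmegaWin v w ∪ OmegaWin w v).indicator (wProb p) u :=
    Set.indicator_nonneg fun u _ => (wProb_pos hp u).le
  have hsum : Summable ((OmegaWin v w ∪ OmegaWin w v).indicator (wProb p)) := by
    refine summable_of_sum_le (c := 1) hnonneg fun s => ?_
    have hsub : s ⊆ wordsOfLengthLE (s.sup List.length) := fun u hu =>
      mem_wordsOfLengthLE.2 (Finset.le_sup (f := List.length) hu)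
    refine (Finset.sum_le_sum_of_subset_of_nonneg hsub fun u _ _ => hnonneg u).trans ?_
    rw [sum_wordsOfLengthLE_indicator hv hne hlen]
    linarith [avoidProb_nonneg hp v w (s.sup List.length)]
  have hmono : Monotone wordsOfLengthLE := fun m n hmn u hu =>
    mem_wordsOfLengthLE.2 ((mem_wordsOfLengthLE.1 hu).trans hmn)
  have h1 := hsum.hasSum.comp (Filter.tendsto_atTop_finset_of_monotone hmono
    fun u => ⟨u.length, mem_wordsOfLengthLE.2 le_rfl⟩)
  have h2 : Filter.Tendsto (fun n => 1 - avoidProb v w p n) Filter.atTop (nhds (1 - 0)) :=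
    (tendsto_avoidProb hv hne hlen hp).const_sub 1
  rw [sub_zero] at h2
  have h3 := tendsto_nhds_unique (h1.congr fun n => sum_wordsOfLengthLE_indicator hv hne hlen p n) h2
  exact h3 ▸ hsum.hasSum

/-- One of the two words almost surely occurs. -/
theorem win_add_win {v w : List Bool} (hv : v ≠ []) (hne : v ≠ w)
    (hlen : v.length = w.length) {p : ℝ} (hp : p ∈ Set.Ioo (0 : ℝ) 1) :
    Win v w p + Win w v p = 1 := by
  have h := hasSum_indicator_omegaWin_union hv hne hlen hp
  have h1 : Summable ((OmegaWin v w).indicator (wProb p)) := by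
    have := h.summable.indicator (OmegaWin v w)
    rwa [Set.indicator_indicator, Set.inter_eq_left.2 Set.subset_union_left] at this
  have h2 : Summable ((OmegaWin w v).indicator (wProb p)) := by
    have := h.summable.indicator (OmegaWin w v)
    rwa [Set.indicator_indicator, Set.inter_eq_left.2 Set.subset_union_right] at this
  rw [Set.indicator_union_of_disjoint (disjoint_omegaWin v w)] at h
  rw [Win, Win, tsum_subtype (OmegaWin v w) (wProb p), tsum_subtype (OmegaWin w v) (wProb p),
    ← h1.tsum_add h2]
  exact h.tsum_eq

theorem win_eq_tsum_omegaStarV_mul (v w : List Bool) (p : ℝ) :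
    Win v w p = (∑' x : OmegaStarV v w, wProb p x) * wProb p v := by
  rw [Win, ← tsum_mul_right]
  let e : OmegaStarV v w → OmegaWin v w := fun x => ⟨x.1 ++ v, x.2⟩
  have he : Function.Bijective e := by
    constructor
    · intro x y h
      exact Subtype.ext (List.append_cancel_right (congrArg Subtype.val h))
    · rintro ⟨u, hu⟩
      obtain ⟨x, rfl⟩ := hu.1
      exact ⟨⟨x, hu⟩, rfl⟩
  rw [← (Equiv.ofBijective e he).tsum_eq]
  exact tsum_congr fun x => wProb_append p x v

/-- For pairs with property `R`, the win probability is `ℙ_p(v)/(ℙ_p(v)+ℙ_p(w))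
= p^s/(p^s + (1-p)^s)` where `s = ‖v‖₁ - ‖w‖₁`. -/
theorem stmt9 (v w : List Bool) (hv : v ≠ []) (hne : v ≠ w)
    (hlen : v.length = w.length) (hR : PropR v w)
    (p : ℝ) (hp : p ∈ Set.Ioo (0:ℝ) 1) :
    Win v w p = wProb p v / (wProb p v + wProb p w) ∧
    Win v w p = p ^ ((v.count true : ℤ) - (w.count true : ℤ)) /
      (p ^ ((v.count true : ℤ) - (w.count true : ℤ)) +
        (1 - p) ^ ((v.count true : ℤ) - (w.count true : ℤ))) := by
  have hstar : OmegaStarV v w = OmegaStarV w v := hR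
  have h1 := win_eq_tsum_omegaStarV_mul v w p
  have h2 := win_eq_tsum_omegaStarV_mul w v p
  rw [← hstar] at h2
  have h3 := win_add_win hv hne hlen hp
  have hPv := wProb_pos hp v
  have hPw := wProb_pos hp w
  have key : Win v w p = wProb p v / (wProb p v + wProb p w) := by
    rw [eq_div_iff (by positivity)]
    linear_combination wProb p v * h3 + wProb p w * h1 - wProb p v * h2
  refine ⟨key, key.trans ?_⟩
  have hp0 : 0 < p := hp.1
  have hq0 : 0 < 1 - p := sub_pos.2 hp.2
  have hs : (v.count true : ℤ) - w.count true = (w.count false : ℤ) - v.count false := by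
    have hlv := List.count_true_add_count_false v
    have hlw := List.count_true_add_count_false w
    omega
  have hps : p ^ ((v.count true : ℤ) - w.count true) = p ^ v.count true / p ^ w.count true := by
    rw [zpow_sub₀ hp0.ne', zpow_natCast, zpow_natCast]
  have hqs : (1 - p) ^ ((v.count true : ℤ) - w.count true) =
      (1 - p) ^ w.count false / (1 - p) ^ v.count false := by
    rw [hs, zpow_sub₀ hq0.ne', zpow_natCast, zpow_natCast]
  rw [hps, hqs]
  simp only [wProb]
  rw [div_add_div _ _ (by positivity) (by positivity), div_div_eq_mul_div,
    div_mul_eq_mul_div, div_div, div_eq_div_iff (by positivity) (by positivity)]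
  ring
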